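/- For all real numbers m̃, ñ sufficiently close to m, n respectively, the ODE φ̃''/(1+(φ̃')²) + ((ñ−1)/r)·φ̃' = (m̃−1)/φ̃ has a unique solution φ̃ with lim_{r↓0} φ̃(r) = 1 and lim_{r↓0} φ̃'(r) = 0; this solution exists on all of (0,∞) and satisfies, for every r > 0: φ̃''(r) > 0, φ̃(r) − r·φ̃'(r) > 0, α̃₀·r < φ̃(r) < α̃₀·r + 1, 0 < φ̃'(r) < α̃₀, and there is κ̃ > 0 with (φ̃(r) − α̃₀r)/(κ̃·r^{γ̃}) → 1 as r → ∞, where α̃₀ = √((m̃−1)/(ñ−1)) and γ̃ = −(m̃+ñ−3)/2 + √(((m̃+ñ−3)/2)² − (m̃+ñ−2)). -/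

import Mathlib

open Set Filter
open scoped ENNReal Topology

noncomputable section

/-- `α₀ = √((m−1)/(n−1))`. -/
def alpha0 (n m : ℕ) : ℝ := Real.sqrt (((m : ℝ) - 1) / ((n : ℝ) - 1))

/-- `γ = −(n+m−3)/2 + √(((n+m−3)/2)² − (n+m−2))`. -/
def gammaExp (n m : ℕ) : ℝ :=
  -(((n : ℝ) + m - 3) / 2) + Real.sqrt ((((n : ℝ) + m - 3) / 2) ^ 2 - ((n : ℝ) + m - 2))

/-- `φ` is a (positive, twice differentiable) solution of the ODE
`φ''/(1+(φ')²) + ((n'−1)/r)·φ' = (m'−1)/φ` on `(0, r₀)` (with `r₀ ∈ (0,∞]`), subject to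
the initial conditions `φ(r) → 1` and `φ'(r) → 0` as `r ↓ 0`. -/
def IsIVPSolTo (n' m' : ℝ) (φ : ℝ → ℝ) (r₀ : ℝ≥0∞) : Prop :=
  (∀ r : ℝ, 0 < r → ENNReal.ofReal r < r₀ →
      0 < φ r ∧ DifferentiableAt ℝ φ r ∧ DifferentiableAt ℝ (deriv φ) r ∧
        deriv (deriv φ) r / (1 + (deriv φ r) ^ 2) + ((n' - 1) / r) * deriv φ r
          = (m' - 1) / φ r) ∧
  Tendsto φ (𝓝[>] (0 : ℝ)) (𝓝 1) ∧
  Tendsto (deriv φ) (𝓝[>] (0 : ℝ)) (𝓝 0)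

/-- `γ̃` for real parameters `m', n'`:
`γ̃ = −(m'+n'−3)/2 + √(((m'+n'−3)/2)² − (m'+n'−2))`. -/
def gammaR (m' n' : ℝ) : ℝ :=
  -((m' + n' - 3) / 2) + Real.sqrt (((m' + n' - 3) / 2) ^ 2 - (m' + n' - 2))

lemma sq_mul_integral_mul_exp_le {l : ℝ} (hl : 0 < l) (r : ℝ) :
    r ^ 2 * ∫ t in (0 : ℝ)..1, t * Real.exp (l * (r * t) ^ 2) ≤ Real.exp (l * r ^ 2) / (2 * l) := by
  have hd : ∀ t ∈ uIcc (0 : ℝ) 1, HasDerivAt (fun t => Real.exp (l * (r * t) ^ 2) / (2 * l))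
      (r ^ 2 * (t * Real.exp (l * (r * t) ^ 2))) t := by
    intro t _
    have h1 : HasDerivAt (fun t : ℝ => l * (r * t) ^ 2) (l * (2 * (r * t) * r)) t := by
      refine ((((hasDerivAt_id' t).const_mul r).fun_pow 2).const_mul l).congr_deriv ?_
      push_cast
      ring
    refine (h1.exp.div_const (2 * l)).congr_deriv ?_
    field_simp
  rw [← intervalIntegral.integral_const_mul,
    intervalIntegral.integral_eq_sub_of_hasDerivAt hd
      (Continuous.intervalIntegrable (by fun_prop) _ _)]
  have : 0 < Real.exp (l * (r * 0) ^ 2) / (2 * l) := by positivity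
  simp only [mul_one] at *
  linarith

lemma continuous_sq_mul_integral {f : ℝ → ℝ} (hf : Continuous f) :
    Continuous fun r : ℝ => r ^ 2 * ∫ s in (0 : ℝ)..1, s * f (r * s) := by
  refine (continuous_pow 2).mul ?_
  refine intervalIntegral.continuous_parametric_intervalIntegral_of_continuous'
    (f := fun r s : ℝ => s * f (r * s)) ?_ 0 1
  simp only [Function.uncurry_def]
  fun_prop

lemma continuous_integral_rpow_mul {f : ℝ → ℝ} (hf : Continuous f) {b : ℝ} (hb : 0 ≤ b) :
    Continuous fun r : ℝ => ∫ t in (0 : ℝ)..1, t ^ b * f (r * t) := by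
  refine intervalIntegral.continuous_parametric_intervalIntegral_of_continuous'
    (f := fun r s : ℝ => s ^ b * f (r * s)) ?_ 0 1
  simp only [Function.uncurry_def]
  have := Real.continuous_rpow_const hb
  fun_prop

/-- If `|f|` is controlled by a Gaussian weight, so is its `r² ∫₀¹ s f(rs) ds` average, with a
gain of `1 / (2 l)`. -/
lemma abs_sq_mul_integral_le {l D : ℝ} (hl : 0 < l) {f : ℝ → ℝ}
    (hf : Continuous f) (h : ∀ r, |f r| ≤ Real.exp (l * r ^ 2) * D) (r : ℝ) :
    |r ^ 2 * ∫ s in (0 : ℝ)..1, s * f (r * s)| ≤ Real.exp (l * r ^ 2) / (2 * l) * D := by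
  have hD : 0 ≤ D := by
    have := (abs_nonneg _).trans (h 0)
    exact nonneg_of_mul_nonneg_right this (Real.exp_pos _)
  rw [abs_mul, abs_of_nonneg (sq_nonneg r)]
  have h1 : |∫ s in (0 : ℝ)..1, s * f (r * s)| ≤
      ∫ s in (0 : ℝ)..1, s * Real.exp (l * (r * s) ^ 2) * D := by
    refine (intervalIntegral.abs_integral_le_integral_abs zero_le_one).trans ?_
    refine intervalIntegral.integral_mono_on zero_le_one
      (Continuous.intervalIntegrable (by fun_prop) _ _)
      (Continuous.intervalIntegrable (by fun_prop) _ _) ?_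
    intro s hs
    rw [abs_mul, abs_of_nonneg hs.1, mul_assoc]
    exact mul_le_mul_of_nonneg_left (h _) hs.1
  rw [intervalIntegral.integral_mul_const] at h1
  have h2 := sq_mul_integral_mul_exp_le hl r
  calc _ ≤ r ^ 2 * ((∫ s in (0 : ℝ)..1, s * Real.exp (l * (r * s) ^ 2)) * D) := by gcongr
    _ = (r ^ 2 * ∫ s in (0 : ℝ)..1, s * Real.exp (l * (r * s) ^ 2)) * D := by ring
    _ ≤ _ := by gcongr

lemma abs_integral_rpow_mul_le {l A B b : ℝ} (hb : 1 ≤ b) (hl : 0 < l) (hA : 0 ≤ A)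
    (hB : 0 ≤ B) {f : ℝ → ℝ} (hf : Continuous f)
    (h : ∀ r, |f r| ≤ Real.exp (l * r ^ 2) * (A * r ^ 2 + B)) (r : ℝ) :
    |∫ t in (0 : ℝ)..1, t ^ b * f (r * t)| ≤ Real.exp (l * r ^ 2) * (A / (2 * l) + B) := by
  have hcb := Real.continuous_rpow_const (zero_le_one.trans hb)
  have h1 : |∫ t in (0 : ℝ)..1, t ^ b * f (r * t)| ≤
      ∫ t in (0 : ℝ)..1, (A * r ^ 2 * (t * Real.exp (l * (r * t) ^ 2))
        + Real.exp (l * r ^ 2) * B) := by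
    refine (intervalIntegral.abs_integral_le_integral_abs zero_le_one).trans ?_
    refine intervalIntegral.integral_mono_on zero_le_one
      (Continuous.intervalIntegrable (by fun_prop) _ _)
      (Continuous.intervalIntegrable (by fun_prop) _ _) ?_
    intro t ht
    have htb0 : 0 ≤ t ^ b := Real.rpow_nonneg ht.1 _
    have htb : t ^ b ≤ t := by
      simpa using Real.rpow_le_rpow_of_exponent_ge' ht.1 ht.2 zero_le_one hb
    have ht2 : t ^ 2 ≤ 1 := pow_le_one₀ ht.1 ht.2
    have hr2 : (r * t) ^ 2 ≤ r ^ 2 := by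
      rw [mul_pow]; exact mul_le_of_le_one_right (sq_nonneg r) ht2
    have he : Real.exp (l * (r * t) ^ 2) ≤ Real.exp (l * r ^ 2) := by gcongr
    rw [abs_mul, abs_of_nonneg htb0]
    calc _ ≤ t ^ b * (Real.exp (l * (r * t) ^ 2) * (A * (r * t) ^ 2 + B)) := by
          gcongr; exact h _
      _ = t ^ b * (Real.exp (l * (r * t) ^ 2) * (A * (r * t) ^ 2))
          + t ^ b * (Real.exp (l * (r * t) ^ 2) * B) := by ring
      _ ≤ t * (Real.exp (l * (r * t) ^ 2) * (A * r ^ 2))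
          + 1 * (Real.exp (l * r ^ 2) * B) := by
          have ht1 := htb.trans ht.2
          have := ht.1
          gcongr
      _ = _ := by ring
  rw [intervalIntegral.integral_add (Continuous.intervalIntegrable (by fun_prop) _ _)
    (Continuous.intervalIntegrable (by fun_prop) _ _), intervalIntegral.integral_const_mul] at h1
  simp only [intervalIntegral.integral_const, sub_zero, one_smul] at h1
  have h2 := sq_mul_integral_mul_exp_le hl r
  have h3 := mul_le_mul_of_nonneg_left h2 hA
  have h4 : Real.exp (l * r ^ 2) * (A / (2 * l) + B) =
    A * (Real.exp (l * r ^ 2) / (2 * l)) + Real.exp (l * r ^ 2) * B := by ring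
  rw [h4]
  linarith

/-- Global solvability of a singular Volterra equation with globally Lipschitz nonlinearity, by
contraction in a space with Gaussian weight. -/
lemma exists_singular_volterra {b K : ℝ} (hb : 1 ≤ b) (hK : 0 < K) {c : ℝ → ℝ}
    (hc : ∀ x y, |c x - c y| ≤ |x - y|) {g : ℝ → ℝ → ℝ → ℝ}
    (hg : Continuous fun p : ℝ × ℝ × ℝ => g p.1 p.2.1 p.2.2)
    (hgl : ∀ r x y u v, |g r x u - g r y v| ≤ K * (r ^ 2 * |x - y| + (1 + r ^ 2) * |u - v|))
    (hgb : ∀ r x u, |g r x u| ≤ K * (1 + r ^ 2)) :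
    ∃ z : ℝ → ℝ, Continuous z ∧ ∀ r, z r = ∫ t in (0 : ℝ)..1, t ^ b *
      g (r * t) (z (r * t)) ((r * t) ^ 2 * ∫ s in (0 : ℝ)..1, s * c (z (r * t * s))) := by
  have hcc : Continuous c := by
    refine (LipschitzWith.of_dist_le_mul (K := 1) fun x y => ?_).continuous
    simpa [Real.dist_eq] using hc x y
  set l : ℝ := 3 * K + 1 with hl
  have hl0 : 0 < l := by positivity
  have hl1 : 1 ≤ l := by linarith
  let N : (ℝ → ℝ) → ℝ → ℝ := fun z r => r ^ 2 * ∫ s in (0 : ℝ)..1, s * c (z (r * s))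
  let F : (ℝ → ℝ) → ℝ → ℝ := fun z r => g r (z r) (N z r)
  let S : (ℝ → ℝ) → ℝ → ℝ := fun z r => ∫ t in (0 : ℝ)..1, t ^ b * F z (r * t)
  have hN : ∀ z : ℝ → ℝ, Continuous z → Continuous (N z) := fun z hz =>
    continuous_sq_mul_integral (hcc.comp hz)
  have hF : ∀ z : ℝ → ℝ, Continuous z → Continuous (F z) := fun z hz =>
    hg.comp (continuous_id.prodMk (hz.prodMk (hN z hz)))
  have hS : ∀ z : ℝ → ℝ, Continuous z → Continuous (S z) := fun z hz =>
    continuous_integral_rpow_mul (hF z hz) (zero_le_one.trans hb)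
  have hSb : ∀ z : ℝ → ℝ, Continuous z → ∀ r, |S z r| ≤ Real.exp (l * r ^ 2) * (K / (2 * l) + K) :=
    fun z hz => abs_integral_rpow_mul_le hb hl0 hK.le hK.le (hF z hz) fun r => by
      refine (hgb _ _ _).trans ?_
      have h1 : 1 ≤ Real.exp (l * r ^ 2) := Real.one_le_exp (by positivity)
      have : 0 ≤ K * (1 + r ^ 2) := by positivity
      nlinarith
  let W : (ℝ → ℝ) → ℝ → ℝ := fun h r => Real.exp (l * r ^ 2) * h r
  have hW : ∀ h : ℝ → ℝ, Continuous h → Continuous (W h) := fun h hh => by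
    simp only [W]; fun_prop
  let T : BoundedContinuousFunction ℝ ℝ → BoundedContinuousFunction ℝ ℝ := fun h =>
    BoundedContinuousFunction.ofNormedAddCommGroup (fun r => Real.exp (-(l * r ^ 2)) * S (W h) r)
      (by have := hS (W h) (hW h h.continuous); fun_prop) (K / (2 * l) + K) (by
        intro r
        have := hSb (W h) (hW h h.continuous) r
        rw [Real.norm_eq_abs, abs_mul, abs_of_pos (Real.exp_pos _), Real.exp_neg,
          inv_mul_le_iff₀ (Real.exp_pos _)]
        exact this)
  have hT : ContractingWith (1 / 2) T := by
    refine ⟨by norm_num, LipschitzWith.of_dist_le_mul fun h k => ?_⟩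
    have hD : 0 ≤ dist h k := dist_nonneg
    refine (BoundedContinuousFunction.dist_le (by positivity)).2 fun r => ?_
    have hz : ∀ r, |W h r - W k r| ≤ Real.exp (l * r ^ 2) * dist h k := fun r => by
      simp only [W]
      rw [← mul_sub, abs_mul, abs_of_pos (Real.exp_pos _)]
      gcongr
      exact BoundedContinuousFunction.dist_coe_le_dist (f := h) (g := k) r
    have hh := hW h h.continuous
    have hk := hW k k.continuous
    have hNd : ∀ r, |N (W h) r - N (W k) r| ≤ Real.exp (l * r ^ 2) / (2 * l) * dist h k :=
      fun r => by
        have := abs_sq_mul_integral_le hl0 ((hcc.comp hh).sub (hcc.comp hk))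
          (fun r => (hc _ _).trans (hz r)) r
        convert this using 2
        simp only [N]
        rw [← mul_sub, ← intervalIntegral.integral_sub
          (Continuous.intervalIntegrable (by fun_prop) _ _)
          (Continuous.intervalIntegrable (by fun_prop) _ _)]
        simp only [mul_sub, Function.comp, Pi.sub_apply]
    have hFd : ∀ r, |F (W h) r - F (W k) r| ≤
        Real.exp (l * r ^ 2) * (2 * K * dist h k * r ^ 2 + K * dist h k / (2 * l)) := fun r => by
      refine (hgl _ _ _ _ _).trans ?_
      have hl2 : 1 / (2 * l) ≤ 1 := by
        rw [div_le_one (by positivity)]; linarith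
      calc _ ≤ K * (r ^ 2 * (Real.exp (l * r ^ 2) * dist h k)
            + (1 + r ^ 2) * (Real.exp (l * r ^ 2) / (2 * l) * dist h k)) := by
            gcongr
            · exact hz r
            · exact hNd r
        _ = K * Real.exp (l * r ^ 2) * dist h k *
            (r ^ 2 + 1 / (2 * l) + r ^ 2 * (1 / (2 * l))) := by ring
        _ ≤ K * Real.exp (l * r ^ 2) * dist h k *
            (r ^ 2 + 1 / (2 * l) + r ^ 2 * 1) := by gcongr
        _ = _ := by ring
    have hSd := abs_integral_rpow_mul_le hb hl0 (by positivity) (by positivity)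
      ((hF _ hh).sub (hF _ hk)) hFd r
    have hcb := Real.continuous_rpow_const (zero_le_one.trans hb)
    have e1 := hF _ hh
    have e2 := hF _ hk
    have hSe : S (W h) r - S (W k) r =
        ∫ t in (0 : ℝ)..1, t ^ b * (F (W h) (r * t) - F (W k) (r * t)) := by
      simp only [S]
      rw [← intervalIntegral.integral_sub
          (Continuous.intervalIntegrable (by fun_prop) _ _)
          (Continuous.intervalIntegrable (by fun_prop) _ _)]
      simp only [mul_sub]
    simp only [Pi.sub_apply] at hSd
    rw [← hSe] at hSd
    simp only [T, BoundedContinuousFunction.coe_ofNormedAddCommGroup, Real.dist_eq]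
    rw [← mul_sub, abs_mul, abs_of_pos (Real.exp_pos _), Real.exp_neg,
          inv_mul_le_iff₀ (Real.exp_pos _)]
    refine hSd.trans ?_
    gcongr
    have : 2 * K * dist h k / (2 * l) + K * dist h k / (2 * l)
      = (3 * K / l) * (1 / 2) * dist h k := by field_simp; ring
    rw [this]
    have h3 : 3 * K / l ≤ 1 := by rw [div_le_one hl0]; linarith
    have : 3 * K / l * (1 / 2) ≤ ((1 / 2 : NNReal) : ℝ) := by
      push_cast; linarith
    gcongr
  let h : BoundedContinuousFunction ℝ ℝ := hT.fixedPoint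
  refine ⟨W h, hW _ h.continuous, fun r => ?_⟩
  have h2 := congrArg (fun f : BoundedContinuousFunction ℝ ℝ => f r) hT.fixedPoint_isFixedPt
  change Real.exp (-(l * r ^ 2)) * S (W h) r = h r at h2
  change Real.exp (l * r ^ 2) * h r = S (W h) r
  rw [← h2, ← mul_assoc, ← Real.exp_add]
  simp

lemma abs_clip_sub_clip_le (C x y : ℝ) :
    |max 0 (min x C) - max 0 (min y C)| ≤ |x - y| := by
  refine (abs_max_sub_max_le_max _ _ _ _).trans ?_
  rw [sub_self, abs_zero, max_eq_right (abs_nonneg _)]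
  refine (abs_min_sub_min_le_max _ _ _ _).trans ?_
  rw [sub_self, abs_zero, max_eq_left (abs_nonneg _)]

/-- The profile equation in the unknowns `φ` and `z = φ' / r`, with `z` truncated to `[0, C]`. -/
lemma exists_truncated_profile {a b C : ℝ} (ha : 0 < a) (hb : 1 ≤ b) (hC : 0 < C) :
    ∃ φ z : ℝ → ℝ, Continuous φ ∧ Continuous z ∧ φ 0 = 1 ∧ z 0 = a / (b + 1) ∧
      (∀ r, 1 ≤ φ r) ∧ ∀ r, 0 < r →
        HasDerivAt φ (r * max 0 (min (z r) C)) r ∧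
        HasDerivAt (fun r => r * z r)
          ((1 + r ^ 2 * max 0 (min (z r) C) ^ 2) * a / φ r
            - b * r ^ 2 * max 0 (min (z r) C) ^ 3 - b * z r) r := by
  set c : ℝ → ℝ := fun x => max 0 (min x C) with hc
  have hc0 : ∀ x, 0 ≤ c x := fun x => le_max_left _ _
  have hcC : ∀ x, c x ≤ C := fun x => max_le hC.le (min_le_right _ _)
  have hcc : Continuous c := by fun_prop
  let g : ℝ → ℝ → ℝ → ℝ := fun r x u =>
    (1 + r ^ 2 * c x ^ 2) * a * (1 + max u 0)⁻¹ - b * r ^ 2 * c x ^ 3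
  set K : ℝ := 2 * a * C + 3 * b * C ^ 2 + a * (1 + C ^ 2) + b * C ^ 3 with hK
  have hb0 : 0 < b := by linarith
  have hK0 : 0 < K := by positivity
  have hpos : ∀ u : ℝ, 0 < 1 + max u 0 := fun u => by
    have := le_max_right u 0
    linarith
  have hinv1 : ∀ u : ℝ, (1 + max u 0)⁻¹ ≤ 1 := fun u =>
    inv_le_one_of_one_le₀ (by linarith [le_max_right u 0])
  have hg : Continuous fun p : ℝ × ℝ × ℝ => g p.1 p.2.1 p.2.2 := by
    have : Continuous fun p : ℝ × ℝ × ℝ => (1 + max p.2.2 0)⁻¹ :=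
      Continuous.inv₀ (by fun_prop) fun p => (hpos _).ne'
    simp only [g]
    fun_prop
  have hgl : ∀ r x y u v, |g r x u - g r y v| ≤
      K * (r ^ 2 * |x - y| + (1 + r ^ 2) * |u - v|) := by
    intro r x y u v
    have hxy := abs_clip_sub_clip_le C x y
    change |c x - c y| ≤ _ at hxy
    have huv : |(1 + max u 0)⁻¹ - (1 + max v 0)⁻¹| ≤ |u - v| := by
      rw [inv_sub_inv (hpos u).ne' (hpos v).ne', abs_div,
        abs_of_pos (mul_pos (hpos u) (hpos v)), div_le_iff₀ (mul_pos (hpos u) (hpos v))]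
      have h1 : |1 + max v 0 - (1 + max u 0)| ≤ |u - v| := by
        rw [abs_sub_comm, add_sub_add_left_eq_sub]
        refine (abs_max_sub_max_le_max _ _ _ _).trans ?_
        simp
      refine h1.trans (le_mul_of_one_le_right (abs_nonneg _) ?_)
      nlinarith [le_max_right u 0, le_max_right v 0]
    have hp0 := hc0 x
    have hq0 := hc0 y
    have hpC := hcC x
    have hqC := hcC y
    have hP0 : 0 < (1 + max u 0)⁻¹ := inv_pos.2 (hpos u)
    have hP1 := hinv1 u
    have key : g r x u - g r y v =
        a * r ^ 2 * ((c x + c y) * (1 + max u 0)⁻¹) * (c x - c y)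
        + a * (1 + r ^ 2 * c y ^ 2) * ((1 + max u 0)⁻¹ - (1 + max v 0)⁻¹)
        - b * r ^ 2 * (c x ^ 2 + c x * c y + c y ^ 2) * (c x - c y) := by
      simp only [g]; ring
    rw [key]
    generalize (1 + max u 0)⁻¹ = P at *
    generalize (1 + max v 0)⁻¹ = Q at *
    generalize c x = p at *
    generalize c y = q at *
    have e1 : |a * r ^ 2 * ((p + q) * P) * (p - q)| ≤ a * r ^ 2 * ((C + C) * 1) * |x - y| := by
      rw [abs_mul, abs_of_nonneg (by positivity)]
      gcongr
    have e2 : |a * (1 + r ^ 2 * q ^ 2) * (P - Q)| ≤ a * (1 + r ^ 2 * C ^ 2) * |u - v| := by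
      rw [abs_mul, abs_of_nonneg (by positivity)]
      gcongr
    have e3 : |b * r ^ 2 * (p ^ 2 + p * q + q ^ 2) * (p - q)| ≤
        b * r ^ 2 * (C ^ 2 + C * C + C ^ 2) * |x - y| := by
      rw [abs_mul, abs_of_nonneg (by positivity)]
      gcongr
    refine (abs_sub _ _).trans ?_
    refine (add_le_add_left (abs_add_le _ _) _).trans ?_
    have hX := abs_nonneg (x - y)
    have hU := abs_nonneg (u - v)
    have : K * (r ^ 2 * |x - y| + (1 + r ^ 2) * |u - v|) -
      (a * r ^ 2 * ((C + C) * 1) * |x - y| + a * (1 + r ^ 2 * C ^ 2) * |u - v|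
        + b * r ^ 2 * (C ^ 2 + C * C + C ^ 2) * |x - y|) =
      (a * (1 + C ^ 2) + b * C ^ 3) * (r ^ 2 * |x - y|)
      + (2 * a * C + 3 * b * C ^ 2 + b * C ^ 3) * ((1 + r ^ 2) * |u - v|)
      + a * (C ^ 2 + r ^ 2) * |u - v| := by rw [hK]; ring
    have : 0 ≤ (a * (1 + C ^ 2) + b * C ^ 3) * (r ^ 2 * |x - y|)
      + (2 * a * C + 3 * b * C ^ 2 + b * C ^ 3) * ((1 + r ^ 2) * |u - v|)
      + a * (C ^ 2 + r ^ 2) * |u - v| := by positivity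
    linarith
  have hgb : ∀ r x u, |g r x u| ≤ K * (1 + r ^ 2) := by
    intro r x u
    have hp0 := hc0 x
    have hpC := hcC x
    have hP0 : 0 < (1 + max u 0)⁻¹ := inv_pos.2 (hpos u)
    have hP1 := hinv1 u
    simp only [g]
    refine (abs_sub _ _).trans ?_
    rw [abs_of_nonneg (by positivity), abs_of_nonneg (by positivity)]
    calc _ ≤ (1 + r ^ 2 * C ^ 2) * a * 1 + b * r ^ 2 * C ^ 3 := by gcongr
      _ ≤ K * (1 + r ^ 2) := by
        have : 0 ≤ (2 * a * C + 3 * b * C ^ 2) * (1 + r ^ 2) + a * C ^ 2 + a * r ^ 2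
          + b * C ^ 3 := by positivity
        rw [hK]
        linarith
  obtain ⟨z, hz, hzeq⟩ := exists_singular_volterra hb hK0 (abs_clip_sub_clip_le C) hg hgl hgb
  let φ : ℝ → ℝ := fun r => 1 + r ^ 2 * ∫ s in (0 : ℝ)..1, s * c (z (r * s))
  have hφc : Continuous φ := continuous_const.add (continuous_sq_mul_integral (hcc.comp hz))
  have hφ1 : ∀ r, 1 ≤ φ r := fun r => by
    have : 0 ≤ ∫ s in (0 : ℝ)..1, s * c (z (r * s)) :=
      intervalIntegral.integral_nonneg zero_le_one fun s hs => mul_nonneg hs.1 (hc0 _)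
    have := mul_nonneg (sq_nonneg r) this
    simp only [φ]; linarith
  let G : ℝ → ℝ := fun r => (1 + r ^ 2 * c (z r) ^ 2) * a / φ r - b * r ^ 2 * c (z r) ^ 3
  have hGc : Continuous G := by
    refine Continuous.sub (Continuous.div (by fun_prop) hφc fun r => ?_) (by fun_prop)
    linarith [hφ1 r]
  have hzG : ∀ r, z r = ∫ t in (0 : ℝ)..1, t ^ b * G (r * t) := fun r => by
    rw [hzeq r]
    refine intervalIntegral.integral_congr fun t _ => ?_
    have h1 := hφ1 (r * t)
    simp only [φ, le_add_iff_nonneg_right] at h1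
    simp only [g, G, φ, div_eq_mul_inv]
    rw [max_eq_left h1]
  have hφint : ∀ r, φ r = 1 + ∫ s in (0 : ℝ)..r, s * c (z s) := fun r => by
    have := intervalIntegral.mul_integral_comp_mul_left (a := 0) (b := 1)
      (f := fun s => s * c (z s)) (c := r)
    simp only [mul_zero, mul_one] at this
    simp only [φ]
    rw [← this, ← intervalIntegral.integral_const_mul, ← intervalIntegral.integral_const_mul]
    congr 2
    ext s
    ring
  have hzint : ∀ r, 0 < r → r ^ b * (r * z r) = ∫ s in (0 : ℝ)..r, s ^ b * G s := fun r hr => by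
    have := intervalIntegral.mul_integral_comp_mul_left (a := 0) (b := 1)
      (f := fun s => s ^ b * G s) (c := r)
    simp only [mul_zero, mul_one] at this
    rw [← this, hzG, mul_left_comm, ← intervalIntegral.integral_const_mul]
    congr 1
    refine intervalIntegral.integral_congr fun t ht => ?_
    rw [uIcc_of_le zero_le_one] at ht
    rw [Real.mul_rpow hr.le ht.1]
    ring
  refine ⟨φ, z, hφc, hz, by simp [φ], ?_, hφ1, fun r hr => ⟨?_, ?_⟩⟩
  · rw [hzG]
    simp only [zero_mul, intervalIntegral.integral_mul_const, G, φ]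
    rw [integral_rpow (Or.inl (by linarith))]
    simp [Real.zero_rpow (by linarith : b + 1 ≠ 0)]
    ring
  · have : HasDerivAt (fun r => 1 + ∫ s in (0 : ℝ)..r, s * c (z s)) (r * c (z r)) r := by
      refine HasDerivAt.const_add _ ?_
      exact intervalIntegral.integral_hasDerivAt_right
        (Continuous.intervalIntegrable (by fun_prop) _ _)
        (Continuous.stronglyMeasurableAtFilter (by fun_prop) _ _)
        (Continuous.continuousAt (by fun_prop))
    exact this.congr_of_eventuallyEq (Eventually.of_forall hφint)
  · have hcb := Real.continuous_rpow_const hb0.le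
    have h1 : HasDerivAt (fun r => ∫ s in (0 : ℝ)..r, s ^ b * G s) (r ^ b * G r) r :=
      intervalIntegral.integral_hasDerivAt_right
        (Continuous.intervalIntegrable (by fun_prop) _ _)
        (Continuous.stronglyMeasurableAtFilter (by fun_prop) _ _)
        (Continuous.continuousAt (by fun_prop))
    have h2 := (Real.hasDerivAt_rpow_const (p := -b) (Or.inl hr.ne')).mul h1
    refine (h2.congr_of_eventuallyEq ?_).congr_deriv ?_
    · filter_upwards [lt_mem_nhds hr] with s hs
      simp only [Pi.mul_apply]
      rw [← hzint s hs, ← mul_assoc, ← Real.rpow_add hs]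
      simp
    · rw [← hzint r hr, Real.rpow_sub hr, Real.rpow_neg hr.le]
      have := (Real.rpow_pos_of_pos hr b).ne'
      simp only [G, Real.rpow_one]
      field_simp
      ring

lemma pos_of_no_first_exit {F : ℝ → ℝ} (hF : Continuous F) (h0 : 0 < F 0)
    (h : ∀ R, 0 < R → (∀ r, 0 < r → r < R → 0 < F r) → 0 < F R) {r : ℝ} (hr : 0 < r) :
    0 < F r := by
  by_contra hneg
  set S : Set ℝ := {x | 0 ≤ x ∧ F x ≤ 0} with hS
  have hSc : IsClosed S := isClosed_Ici.inter (isClosed_le hF continuous_const)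
  have hSb : BddBelow S := ⟨0, fun x hx => hx.1⟩
  have hmem : sInf S ∈ S := hSc.csInf_mem ⟨r, hr.le, not_lt.1 hneg⟩ hSb
  have hpos : 0 < sInf S := by
    refine lt_of_le_of_ne hmem.1 fun h => ?_
    rw [← h] at hmem
    exact absurd hmem.2 (not_le.2 h0)
  refine absurd hmem.2 (not_le.2 (h _ hpos fun x hx hxS => ?_))
  by_contra hx'
  exact absurd (csInf_le hSb ⟨hx.le, not_lt.1 hx'⟩) (not_le.2 hxS)

lemma hasDerivAt_nonpos_of_pos_left {f : ℝ → ℝ} {f' R : ℝ} (hf : HasDerivAt f f' R)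
    (hR : 0 < R) (h0 : f R = 0) (hpos : ∀ r, 0 < r → r < R → 0 < f r) : f' ≤ 0 := by
  have h1 : Tendsto (slope f R) (𝓝[<] R) (𝓝 f') :=
    (hasDerivAt_iff_tendsto_slope.1 hf).mono_left
      (nhdsWithin_mono _ fun x (hx : x < R) => hx.ne)
  refine le_of_tendsto h1 ?_
  filter_upwards [Ioo_mem_nhdsLT hR] with x hx
  rw [slope_def_field, h0, sub_zero]
  exact div_nonpos_of_nonneg_of_nonpos (hpos x hx.1 hx.2).le (by linarith [hx.2])

/-- The two barriers `φφ' < α² r` and `φ' (5 φ - 3 α r) > 2 α² r` confine the slope below `α` and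
the profile above the cone. -/
lemma lt_of_barriers {α r f v : ℝ} (hα : 0 < α) (hr : 0 < r) (hv : 0 < v)
    (hP : f * v < α ^ 2 * r) (hQ : 3 * α * r * v + 2 * α ^ 2 * r < 5 * f * v) :
    v < α ∧ α * r < f := by
  have h1 : v < α := by
    have : (3 * α * r) * v < (3 * α * r) * α := by nlinarith
    exact lt_of_mul_lt_mul_left this (by positivity)
  refine ⟨h1, ?_⟩
  have h2 : 0 < 5 * f - 3 * α * r := by
    have : 0 < (5 * f - 3 * α * r) * v := by nlinarith [mul_pos (pow_pos hα 2) hr]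
    exact pos_of_mul_pos_left this hv.le
  have h3 : 2 * α * r * α < (5 * f - 3 * α * r) * α := by nlinarith
  have := lt_of_mul_lt_mul_right h3 hα.le
  linarith

lemma slope_defect_bound {α r f v : ℝ} (hα : 0 < α) (hr : 0 < r)
    (hw : α * r < f) (hQ : 3 * α * r * v + 2 * α ^ 2 * r < 5 * f * v) :
    0 < 2 * r * (v - α) + 5 * (f - α * r) := by
  have hD : 0 < 5 * f - 3 * α * r := by nlinarith [mul_pos hα hr]
  have : 0 < (2 * r * (v - α) + 5 * (f - α * r)) * (5 * f - 3 * α * r) := by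
    have e : (2 * r * (v - α) + 5 * (f - α * r)) * (5 * f - 3 * α * r) =
      2 * r * (5 * f * v - (3 * α * r * v + 2 * α ^ 2 * r)) + 25 * (f - α * r) ^ 2 := by ring
    rw [e]
    have := mul_pos hr (sub_pos.2 hQ)
    nlinarith [sq_nonneg (f - α * r)]
  exact pos_of_mul_pos_left this hD.le

lemma barrier_form_pos {a b q f : ℝ} (hb : 1.99 ≤ b) (hab : 5.98 ≤ a + b)
    (hq : 0 < q) (hqf : q < f) :
    0 < 3 * (b * (5 * f - 3 * q) ^ 2 + 4 * a * q ^ 2) - 50 * f ^ 2 - 20 * q * f := by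
  have h1 : 0 ≤ (b - 1.99) * ((f - q) * (5 * f - q)) :=
    mul_nonneg (by linarith) (mul_nonneg (by linarith) (by linarith))
  have h2 : 0 ≤ (a + b - 5.98) * q ^ 2 := mul_nonneg (by linarith) (sq_nonneg q)
  nlinarith [sq_nonneg (f - 0.98 * q), sq_pos_of_pos hq]

/-- On the lower barrier curve the lower barrier quantity has positive derivative. -/
lemma lower_barrier_deriv_pos {a b α r f v : ℝ} (hb : 1.99 ≤ b) (hab : 5.98 ≤ a + b)
    (hα : 0 < α) (ha : a = b * α ^ 2) (hr : 0 < r) (hw : α * r < f)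
    (hQ : 5 * f * v = 3 * α * r * v + 2 * α ^ 2 * r) :
    0 < (5 * v + 2 * α) * (v - α) +
      (5 * f - 3 * α * r) * ((1 + v ^ 2) * (a / f - b * v / r)) := by
  have hq : 0 < α * r := mul_pos hα hr
  have hf : 0 < f := hq.trans hw
  set D := 5 * f - 3 * α * r with hD
  have hDpos : 0 < D := by linarith
  have hv : v = 2 * α ^ 2 * r / D := by
    rw [eq_div_iff hDpos.ne', hD]; linarith
  have key := barrier_form_pos hb hab hq hw
  have e : (5 * v + 2 * α) * (v - α) + D * ((1 + v ^ 2) * (a / f - b * v / r)) =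
      α ^ 2 * (f - α * r) / (D ^ 2 * f) *
        (3 * (b * (5 * f - 3 * (α * r)) ^ 2 + 4 * a * (α * r) ^ 2) - 50 * f ^ 2
          - 20 * (α * r) * f) := by
    rw [hv, ha]
    have hf' : 5 * f = D + 3 * α * r := by rw [hD]; ring
    have hf'' : f = (D + 3 * α * r) / 5 := by linarith
    have : D + 3 * α * r ≠ 0 := by rw [← hf']; positivity
    clear_value D
    subst hf''
    field_simp
    ring
  rw [e]
  have : 0 < f - α * r := sub_pos.2 hw
  positivity

lemma exists_profile {a b α : ℝ} (ha : 0 < a) (hb : 1.99 ≤ b) (hab : 5.98 ≤ a + b)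
    (hα : 0 < α) (haα : a = b * α ^ 2) :
    ∃ φ v : ℝ → ℝ, Tendsto φ (𝓝[>] 0) (𝓝 1) ∧ Tendsto v (𝓝[>] 0) (𝓝 0) ∧
      ∀ r, 0 < r → HasDerivAt φ (v r) r ∧
        HasDerivAt v ((1 + v r ^ 2) * (a / φ r - b * v r / r)) r ∧
        0 < v r ∧ φ r * v r < α ^ 2 * r ∧ 3 * α * r * v r + 2 * α ^ 2 * r < 5 * φ r * v r := by
  set C : ℝ := (1 + α ^ 2) * a + 1 with hC
  have hC0 : 0 < C := by positivity
  have hb0 : 0 < b := by linarith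
  obtain ⟨φ, z, hφ, hz, hφ0, hz0, hφ1, hd⟩ :=
    exists_truncated_profile ha (by linarith : 1 ≤ b) hC0
  let v : ℝ → ℝ := fun r => r * z r
  have hvc : Continuous v := by fun_prop
  have hode : ∀ r, 0 < r → 0 ≤ z r → z r ≤ C → HasDerivAt φ (v r) r ∧
      HasDerivAt v ((1 + v r ^ 2) * (a / φ r - b * v r / r)) r := by
    intro r hr h0 h1
    obtain ⟨h2, h3⟩ := hd r hr
    rw [min_eq_left h1, max_eq_right h0] at h2 h3
    refine ⟨h2, h3.congr_deriv ?_⟩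
    have := (zero_lt_one.trans_le (hφ1 r)).ne'
    simp only [v]
    field_simp
    ring
  let F : ℝ → ℝ := fun r => min (min (z r) (C - z r))
    (min (α ^ 2 - φ r * z r) (5 * φ r * z r - 3 * α * r * z r - 2 * α ^ 2))
  have hF : Continuous F := by fun_prop
  have hF0 : 0 < F 0 := by
    have e1 : α ^ 2 = a / b := by rw [haα]; field_simp
    simp only [F, hφ0, hz0, lt_min_iff, e1]
    refine ⟨⟨by positivity, ?_⟩, ?_, ?_⟩
    · have : a / (b + 1) ≤ a := div_le_self ha.le (by linarith)
      nlinarith [sq_nonneg α]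
    · rw [one_mul, sub_pos]
      exact div_lt_div_of_pos_left ha hb0 (by linarith)
    · have : 5 * 1 * (a / (b + 1)) - 3 * α * 0 * (a / (b + 1)) - 2 * (a / b) =
        a * (3 * b - 2) / (b * (b + 1)) := by field_simp; ring
      rw [this]
      have : 0 < 3 * b - 2 := by linarith
      positivity
  have hFstep : ∀ R, 0 < R → (∀ r, 0 < r → r < R → 0 < F r) → 0 < F R := by
    intro R hR hgood
    have hin : ∀ r, 0 < r → r < R → 0 < v r ∧ z r < C ∧ φ r * v r < α ^ 2 * r ∧
        3 * α * r * v r + 2 * α ^ 2 * r < 5 * φ r * v r := by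
      intro r hr hrR
      have := hgood r hr hrR
      simp only [F, lt_min_iff] at this
      obtain ⟨⟨h1, h2⟩, h3, h4⟩ := this
      have h3' := mul_pos hr h3
      have h4' := mul_pos hr h4
      refine ⟨mul_pos hr h1, by linarith, ?_, ?_⟩ <;> simp only [v] <;> nlinarith
    have hode' : ∀ r, 0 < r → r < R → HasDerivAt φ (v r) r ∧
        HasDerivAt v ((1 + v r ^ 2) * (a / φ r - b * v r / r)) r := fun r hr hrR =>
      hode r hr (pos_of_mul_pos_right (hin r hr hrR).1 hr.le).le (hin r hr hrR).2.1.le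
    have hcl : ∀ {f : ℝ → ℝ}, Continuous f → (∀ r, 0 < r → r < R → 0 < f r) → 0 ≤ f R := by
      intro f hf h
      have h1 : Tendsto f (𝓝[<] R) (𝓝 (f R)) := (hf.tendsto R).mono_left nhdsWithin_le_nhds
      refine ge_of_tendsto h1 ?_
      filter_upwards [Ioo_mem_nhdsLT hR] with x hx using (h x hx.1 hx.2).le
    have hR2 : 0 < R / 2 := by positivity
    have hR2R : R / 2 < R := by linarith
    have hvR : 0 < v R := by
      have hmono : MonotoneOn v (Icc (R / 2) R) := by
        refine monotoneOn_of_deriv_nonneg (convex_Icc _ _) hvc.continuousOn ?_ ?_ <;>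
          rw [interior_Icc] <;> intro r hr
        · exact (hode' r (hR2.trans hr.1) hr.2).2.differentiableAt.differentiableWithinAt
        · have hr0 := hR2.trans hr.1
          rw [(hode' r hr0 hr.2).2.deriv]
          have hφr := zero_lt_one.trans_le (hφ1 r)
          have h2 := (hin r hr0 hr.2).2.2.1
          refine mul_nonneg (by positivity) (sub_nonneg.2 ?_)
          rw [div_le_div_iff₀ hr0 hφr, haα]
          nlinarith
      exact (hin _ hR2 hR2R).1.trans_le
        (hmono ⟨le_rfl, hR2R.le⟩ ⟨hR2R.le, le_rfl⟩ hR2R.le)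
    have hzR : 0 < z R := pos_of_mul_pos_right hvR hR.le
    have hzC : z R < C := by
      have hanti : AntitoneOn (fun r => v r - (1 + α ^ 2) * a * r) (Icc 0 R) := by
        refine antitoneOn_of_deriv_nonpos (convex_Icc _ _) (by fun_prop) ?_ ?_ <;>
          rw [interior_Icc] <;> intro r hr
        · have := (hode' r hr.1 hr.2).2.differentiableAt
          exact DifferentiableAt.differentiableWithinAt (by fun_prop)
        · have hφr := zero_lt_one.trans_le (hφ1 r)
          obtain ⟨i1, -, i2, i3⟩ := hin r hr.1 hr.2
          have hlt := (lt_of_barriers hα hr.1 i1 i2 i3).1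
          have hdr := (hode' r hr.1 hr.2).2.sub
            ((hasDerivAt_id' r).const_mul ((1 + α ^ 2) * a))
          change deriv (v - fun r => (1 + α ^ 2) * a * r) r ≤ 0
          rw [hdr.deriv, mul_one, sub_nonpos]
          have h5 : a / φ r ≤ a := div_le_self ha.le (hφ1 r)
          have h6 : 0 < b * v r / r := by have := hr.1; positivity
          calc _ ≤ (1 + v r ^ 2) * a := by gcongr; linarith
            _ ≤ _ := by gcongr
      have := hanti ⟨le_rfl, hR.le⟩ ⟨hR.le, le_rfl⟩ hR.le
      simp only [v, zero_mul, mul_zero, sub_zero] at this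
      have h7 : R * z R ≤ R * ((1 + α ^ 2) * a) := by linarith
      have := le_of_mul_le_mul_left h7 hR
      linarith
    obtain ⟨hdφ, hdv⟩ := hode R hR hzR.le hzC.le
    have hwin : ∀ r, 0 < r → r < R → 0 < φ r - α * r := fun r hr hrR => by
      obtain ⟨i1, -, i2, i3⟩ := hin r hr hrR
      exact sub_pos.2 (lt_of_barriers hα hr i1 i2 i3).2
    have hwR : α * R < φ R := by
      have hw0 : 0 ≤ φ R - α * R := hcl (f := fun r => φ r - α * r) (by fun_prop) hwin
      have hmono : MonotoneOn (fun r => (φ r - α * r) ^ 2 * r ^ 5) (Icc (R / 2) R) := by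
        have hdw : ∀ r, R / 2 < r → r < R → HasDerivAt (fun r => (φ r - α * r) ^ 2 * r ^ 5)
            ((φ r - α * r) * r ^ 4 * (2 * r * (v r - α) + 5 * (φ r - α * r))) r := by
          intro r hr hrR
          have h1 := (hode' r (hR2.trans hr) hrR).1
          refine (((h1.fun_sub ((hasDerivAt_id' r).const_mul α)).fun_pow 2).fun_mul
            (hasDerivAt_pow 5 r)).congr_deriv ?_
          push_cast
          ring
        refine monotoneOn_of_deriv_nonneg (convex_Icc _ _) (by fun_prop) ?_ ?_ <;>
          rw [interior_Icc] <;> intro r hr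
        · exact (hdw r hr.1 hr.2).differentiableAt.differentiableWithinAt
        · rw [(hdw r hr.1 hr.2).deriv]
          have hr0 := hR2.trans hr.1
          obtain ⟨i1, -, i2, i3⟩ := hin r hr0 hr.2
          have h1 := hwin r hr0 hr.2
          have h2 := slope_defect_bound hα hr0 (sub_pos.1 h1) i3
          positivity
      have h1 := hmono ⟨le_rfl, hR2R.le⟩ ⟨hR2R.le, le_rfl⟩ hR2R.le
      have h2 : 0 < (φ (R / 2) - α * (R / 2)) ^ 2 * (R / 2) ^ 5 := by
        have := hwin _ hR2 hR2R
        positivity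
      have h3 := h2.trans_le h1
      rcases hw0.lt_or_eq with h | h
      · linarith
      · simp [← h] at h3
    have hφR := zero_lt_one.trans_le (hφ1 R)
    have hP : 0 < α ^ 2 * R - φ R * v R := by
      have h0 : 0 ≤ α ^ 2 * R - φ R * v R := hcl (f := fun r => α ^ 2 * r - φ r * v r)
        (by fun_prop) fun r hr hrR => sub_pos.2 (hin r hr hrR).2.2.1
      refine lt_of_le_of_ne h0 fun h => ?_
      have h1 := ((hasDerivAt_id' R).const_mul (α ^ 2)).fun_sub (hdφ.fun_mul hdv)
      have h2 := hasDerivAt_nonpos_of_pos_left h1 hR h.symm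
        fun r hr hrR => sub_pos.2 (hin r hr hrR).2.2.1
      have h3 : a / φ R - b * v R / R = 0 := by
        rw [sub_eq_zero, div_eq_div_iff hφR.ne' hR.ne', haα]
        linear_combination b * h.symm
      rw [h3] at h2
      have h4 : α ≤ v R := by nlinarith
      nlinarith
    have hQ : 0 < 5 * φ R * v R - (3 * α * R * v R + 2 * α ^ 2 * R) := by
      have h0 : 0 ≤ 5 * φ R * v R - (3 * α * R * v R + 2 * α ^ 2 * R) :=
        hcl (f := fun r => 5 * φ r * v r - (3 * α * r * v r + 2 * α ^ 2 * r))
        (by fun_prop) fun r hr hrR => sub_pos.2 (hin r hr hrR).2.2.2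
      refine lt_of_le_of_ne h0 fun h => ?_
      have h1 := ((hdφ.const_mul 5).fun_mul hdv).fun_sub
        ((((hasDerivAt_id' R).const_mul (3 * α)).fun_mul hdv).fun_add
          ((hasDerivAt_id' R).const_mul (2 * α ^ 2)))
      have h2 := hasDerivAt_nonpos_of_pos_left h1 hR h.symm
        fun r hr hrR => sub_pos.2 (hin r hr hrR).2.2.2
      have h3 := lower_barrier_deriv_pos hb hab hα haα hR hwR (sub_eq_zero.1 h.symm)
      linarith
    simp only [F, lt_min_iff]
    refine ⟨⟨hzR, by linarith⟩, ?_, ?_⟩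
    · have : 0 < R * (α ^ 2 - φ R * z R) := by simp only [v] at hP; linarith
      exact pos_of_mul_pos_right this hR.le
    · have : 0 < R * (5 * φ R * z R - 3 * α * R * z R - 2 * α ^ 2) := by
        simp only [v] at hQ; linarith
      exact pos_of_mul_pos_right this hR.le
  refine ⟨φ, v, ?_, ?_, fun r hr => ?_⟩
  · have := (hφ.tendsto 0).mono_left (nhdsWithin_le_nhds (s := Ioi 0))
    rwa [hφ0] at this
  · have := (hvc.tendsto 0).mono_left (nhdsWithin_le_nhds (s := Ioi 0))
    simpa [v] using this
  · have := pos_of_no_first_exit hF hF0 hFstep hr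
    simp only [F, lt_min_iff] at this
    obtain ⟨⟨h1, h2⟩, h3, h4⟩ := this
    have h3' := mul_pos hr h3
    have h4' := mul_pos hr h4
    obtain ⟨h5, h6⟩ := hode r hr h1.le (by linarith)
    refine ⟨h5, h6, mul_pos hr h1, ?_, ?_⟩ <;> simp only [v] <;> linarith

lemma exists_abs_le_of_tendsto {f : ℝ → ℝ} {c R : ℝ} (hf : ContinuousOn f (Ioc 0 R))
    (hlim : Tendsto f (𝓝[>] 0) (𝓝 c)) : ∃ B, ∀ r ∈ Ioc 0 R, |f r| ≤ B := by
  have h1 : ∀ᶠ r in 𝓝[>] (0 : ℝ), |f r| < |c| + 1 :=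
    hlim.abs.eventually_lt_const (lt_add_one _)
  obtain ⟨ε, hε, hlt⟩ := mem_nhdsGT_iff_exists_Ioo_subset.1 h1
  obtain ⟨B, hB⟩ := (isCompact_Icc (a := ε) (b := R)).exists_bound_of_continuousOn
    (hf.mono fun x hx => ⟨lt_of_lt_of_le hε hx.1, hx.2⟩)
  refine ⟨max (|c| + 1) B, fun r hr => ?_⟩
  rcases lt_or_ge r ε with h | h
  · exact le_max_of_le_left (le_of_lt (hlt ⟨hr.1, h⟩))
  · exact le_max_of_le_right (hB r ⟨h, hr.2⟩)

lemma slope_diff_bound {a b r φ v ψ y B : ℝ} (ha : 0 < a) (hb : 0 < b) (hr : 0 < r)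
    (hφ : 0 < φ) (hψ : 0 < ψ) (hφB : |φ⁻¹| ≤ B) (hψB : |ψ⁻¹| ≤ B) (hv : |v| ≤ B) (hy : |y| ≤ B) :
    2 * (y - v) * ((1 + y ^ 2) * (a / ψ - b * y / r) - (1 + v ^ 2) * (a / φ - b * v / r)) ≤
      (4 * a * B ^ 2 + a * (1 + B ^ 2) * B ^ 2) * ((ψ - φ) ^ 2 + (y - v) ^ 2) := by
  have hB : 0 ≤ B := (abs_nonneg _).trans hv
  have hP : 0 < φ⁻¹ := inv_pos.2 hφ
  have hQ : 0 < ψ⁻¹ := inv_pos.2 hψ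
  rw [abs_of_pos hP] at hφB
  rw [abs_of_pos hQ] at hψB
  have e : 2 * (y - v) * ((1 + y ^ 2) * (a / ψ - b * y / r) - (1 + v ^ 2) * (a / φ - b * v / r)) =
      -(2 * b / r * (1 + (y ^ 2 + y * v + v ^ 2)) * (y - v) ^ 2)
      + 2 * a * ψ⁻¹ * (y + v) * (y - v) ^ 2
      + a * (1 + v ^ 2) * (φ⁻¹ * ψ⁻¹) * (2 * ((φ - ψ) * (y - v))) := by
    field_simp
    ring
  have h1 : 0 ≤ y ^ 2 + y * v + v ^ 2 := by nlinarith [sq_nonneg (y + v), sq_nonneg y, sq_nonneg v]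
  have h2 : 0 ≤ 2 * b / r * (1 + (y ^ 2 + y * v + v ^ 2)) * (y - v) ^ 2 := by positivity
  have h3 : 2 * a * ψ⁻¹ * (y + v) * (y - v) ^ 2 ≤ 2 * a * B * (B + B) * (y - v) ^ 2 := by
    have : y + v ≤ B + B := add_le_add (le_of_abs_le hy) (le_of_abs_le hv)
    have hm : ψ⁻¹ * (y + v) ≤ B * (B + B) := by
      calc _ ≤ ψ⁻¹ * (B + B) := by gcongr
        _ ≤ B * (B + B) := by gcongr
    calc _ = 2 * a * (ψ⁻¹ * (y + v)) * (y - v) ^ 2 := by ring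
      _ ≤ 2 * a * (B * (B + B)) * (y - v) ^ 2 := by gcongr
      _ = _ := by ring
  have hv2 : v ^ 2 ≤ B ^ 2 := sq_le_sq' (neg_le_of_abs_le hv) (le_of_abs_le hv)
  have h4 : a * (1 + v ^ 2) * (φ⁻¹ * ψ⁻¹) * (2 * ((φ - ψ) * (y - v))) ≤
      a * (1 + B ^ 2) * (B * B) * ((ψ - φ) ^ 2 + (y - v) ^ 2) := by
    calc _ ≤ a * (1 + v ^ 2) * (φ⁻¹ * ψ⁻¹) * ((ψ - φ) ^ 2 + (y - v) ^ 2) := by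
          gcongr
          nlinarith [sq_nonneg (φ - ψ - (y - v))]
      _ ≤ _ := by gcongr
  have h5 : 2 * a * B * (B + B) * (y - v) ^ 2 ≤
      4 * a * B ^ 2 * ((ψ - φ) ^ 2 + (y - v) ^ 2) := by
    have : 0 ≤ 4 * a * B ^ 2 * (ψ - φ) ^ 2 := by positivity
    linarith
  rw [e]
  linarith

lemma profile_unique {a b R : ℝ} (ha : 0 < a) (hb : 0 < b) (hR : 0 < R) {φ v ψ y : ℝ → ℝ}
    (hφ : ∀ r ∈ Ioc 0 R, 0 < φ r ∧ HasDerivAt φ (v r) r ∧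
      HasDerivAt v ((1 + v r ^ 2) * (a / φ r - b * v r / r)) r)
    (hψ : ∀ r ∈ Ioc 0 R, 0 < ψ r ∧ HasDerivAt ψ (y r) r ∧
      HasDerivAt y ((1 + y r ^ 2) * (a / ψ r - b * y r / r)) r)
    (hφ0 : Tendsto φ (𝓝[>] 0) (𝓝 1)) (hv0 : Tendsto v (𝓝[>] 0) (𝓝 0))
    (hψ0 : Tendsto ψ (𝓝[>] 0) (𝓝 1)) (hy0 : Tendsto y (𝓝[>] 0) (𝓝 0)) : ψ R = φ R := by
  obtain ⟨B1, hB1⟩ := exists_abs_le_of_tendsto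
    (fun r hr => (hφ r hr).2.2.continuousAt.continuousWithinAt) hv0
  obtain ⟨B2, hB2⟩ := exists_abs_le_of_tendsto
    (fun r hr => (hψ r hr).2.2.continuousAt.continuousWithinAt) hy0
  obtain ⟨B3, hB3⟩ := exists_abs_le_of_tendsto (f := fun r => (φ r)⁻¹)
    (fun r hr => ((hφ r hr).2.1.continuousAt.inv₀ (hφ r hr).1.ne').continuousWithinAt)
    (hφ0.inv₀ one_ne_zero)
  obtain ⟨B4, hB4⟩ := exists_abs_le_of_tendsto (f := fun r => (ψ r)⁻¹)
    (fun r hr => ((hψ r hr).2.1.continuousAt.inv₀ (hψ r hr).1.ne').continuousWithinAt)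
    (hψ0.inv₀ one_ne_zero)
  set B := max (max B1 B2) (max B3 B4)
  have b1 : B1 ≤ B := (le_max_left _ _).trans (le_max_left _ _)
  have b2 : B2 ≤ B := (le_max_right _ _).trans (le_max_left _ _)
  have b3 : B3 ≤ B := (le_max_left _ _).trans (le_max_right _ _)
  have b4 : B4 ≤ B := (le_max_right _ _).trans (le_max_right _ _)
  set K : ℝ := 1 + (4 * a * B ^ 2 + a * (1 + B ^ 2) * B ^ 2)
  let E : ℝ → ℝ := fun r => ((ψ r - φ r) ^ 2 + (y r - v r) ^ 2) * Real.exp (-(K * r))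
  have hE : ∀ r ∈ Ioc 0 R, HasDerivAt E ((2 * (ψ r - φ r) * (y r - v r) + 2 * (y r - v r) *
      ((1 + y r ^ 2) * (a / ψ r - b * y r / r) - (1 + v r ^ 2) * (a / φ r - b * v r / r))
      - K * ((ψ r - φ r) ^ 2 + (y r - v r) ^ 2)) * Real.exp (-(K * r))) r := by
    intro r hr
    obtain ⟨-, p1, p2⟩ := hφ r hr
    obtain ⟨-, q1, q2⟩ := hψ r hr
    refine ((((q1.fun_sub p1).fun_pow 2).fun_add ((q2.fun_sub p2).fun_pow 2)).fun_mul
      (((hasDerivAt_id' r).const_mul K).fun_neg.exp)).congr_deriv ?_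
    push_cast
    ring
  have hanti : AntitoneOn E (Ioc 0 R) := by
    refine antitoneOn_of_deriv_nonpos (convex_Ioc _ _)
      (fun r hr => (hE r hr).continuousAt.continuousWithinAt)
      (fun r hr => (hE r (interior_subset hr)).differentiableAt.differentiableWithinAt)
      fun r hr => ?_
    replace hr := interior_subset hr
    rw [(hE r hr).deriv]
    refine mul_nonpos_of_nonpos_of_nonneg ?_ (Real.exp_pos _).le
    have h1 := slope_diff_bound ha hb hr.1 (hφ r hr).1 (hψ r hr).1 ((hB3 r hr).trans b3)
      ((hB4 r hr).trans b4) ((hB1 r hr).trans b1) ((hB2 r hr).trans b2)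
    have h2 := sq_nonneg (ψ r - φ r - (y r - v r))
    have h3 : K * ((ψ r - φ r) ^ 2 + (y r - v r) ^ 2) = ((ψ r - φ r) ^ 2 + (y r - v r) ^ 2) +
      (4 * a * B ^ 2 + a * (1 + B ^ 2) * B ^ 2) * ((ψ r - φ r) ^ 2 + (y r - v r) ^ 2) := by ring
    rw [h3]
    linarith
  have hlim : Tendsto E (𝓝[>] 0) (𝓝 0) := by
    have h1 : Tendsto (fun r => Real.exp (-(K * r))) (𝓝[>] 0) (𝓝 (Real.exp (-(K * 0)))) :=
      (Continuous.tendsto (by fun_prop) 0).mono_left nhdsWithin_le_nhds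
    simpa using (((hψ0.sub hφ0).pow 2).add ((hy0.sub hv0).pow 2)).mul h1
  have hER : E R ≤ 0 := by
    refine ge_of_tendsto hlim ?_
    filter_upwards [Ioc_mem_nhdsGT hR] with r hr using hanti hr ⟨hR, le_rfl⟩ hr.2
  have h1 : (ψ R - φ R) ^ 2 + (y R - v R) ^ 2 ≤ 0 :=
    nonpos_of_mul_nonpos_left hER (Real.exp_pos _)
  have h2 : (ψ R - φ R) ^ 2 = 0 := le_antisymm (by nlinarith [sq_nonneg (y R - v R)]) (sq_nonneg _)
  exact sub_eq_zero.1 (pow_eq_zero_iff two_ne_zero |>.1 h2)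

lemma tendsto_of_abs_deriv_le {h h' : ℝ → ℝ} {K : ℝ} (hK : 0 ≤ K)
    (hd : ∀ r, 0 < r → HasDerivAt h (h' r) r) (hpos : ∀ r, 0 < r → 0 < h r)
    (hb : ∀ r, 0 < r → |h' r| ≤ K * h r / r ^ 2) :
    ∃ L, 0 < L ∧ Tendsto h atTop (𝓝 L) := by
  have hexp : ∀ c r : ℝ, 0 < r → HasDerivAt (fun r => h r * Real.exp (c / r))
      ((h' r - c * h r / r ^ 2) * Real.exp (c / r)) r := fun c r hr => by
    have h1 : HasDerivAt (fun r : ℝ => c / r) (-c / r ^ 2) r := by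
      refine ((hasDerivAt_inv hr.ne').const_mul c).congr_deriv ?_
      ring
    refine ((hd r hr).fun_mul h1.exp).congr_deriv ?_
    ring
  let A : ℝ → ℝ := fun r => h r * Real.exp (-K / r)
  have hmono : MonotoneOn A (Ioi 0) := by
    refine monotoneOn_of_deriv_nonneg (convex_Ioi _)
      (fun r hr => (hexp _ r hr).continuousAt.continuousWithinAt)
      (fun r hr => (hexp _ r (interior_subset hr)).differentiableAt.differentiableWithinAt)
      fun r hr => ?_
    replace hr : 0 < r := interior_subset hr
    rw [(hexp _ r hr).deriv]
    have := neg_le_of_abs_le (hb r hr)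
    refine mul_nonneg ?_ (Real.exp_pos _).le
    have e : -K * h r / r ^ 2 = -(K * h r / r ^ 2) := by ring
    rw [e]
    linarith
  have hanti : AntitoneOn (fun r => h r * Real.exp (K / r)) (Ioi 0) := by
    refine antitoneOn_of_deriv_nonpos (convex_Ioi _)
      (fun r hr => (hexp _ r hr).continuousAt.continuousWithinAt)
      (fun r hr => (hexp _ r (interior_subset hr)).differentiableAt.differentiableWithinAt)
      fun r hr => ?_
    replace hr : 0 < r := interior_subset hr
    rw [(hexp _ r hr).deriv]
    have := le_of_abs_le (hb r hr)
    exact mul_nonpos_of_nonpos_of_nonneg (by linarith) (Real.exp_pos _).le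
  have h1 : ∀ r : ℝ, 0 < max r 1 := fun r => lt_max_of_lt_right one_pos
  have hAm : Monotone fun r => A (max r 1) := fun r s hrs =>
    hmono (h1 r) (h1 s) (max_le_max_right _ hrs)
  have hbdd : BddAbove (range fun r => A (max r 1)) := by
    refine ⟨h 1 * Real.exp (K / 1), ?_⟩
    rintro _ ⟨r, rfl⟩
    refine le_trans ?_ (hanti (mem_Ioi.2 one_pos) (h1 r) (le_max_right r 1))
    have := hpos _ (h1 r)
    simp only [A]
    gcongr
    linarith
  have hlim := tendsto_atTop_ciSup hAm hbdd
  set L := ⨆ r, A (max r 1)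
  refine ⟨L, ?_, ?_⟩
  · have h2 : A (max 1 1) ≤ L := le_ciSup hbdd 1
    refine lt_of_lt_of_le ?_ h2
    have := hpos _ (h1 1)
    simp only [A]
    positivity
  · have h2 : Tendsto (fun r : ℝ => Real.exp (K / r)) atTop (𝓝 (Real.exp 0)) :=
      (Real.continuous_exp.tendsto 0).comp (tendsto_const_nhds.div_atTop tendsto_id)
    have h3 := hlim.mul h2
    rw [Real.exp_zero, mul_one] at h3
    refine h3.congr' ?_
    filter_upwards [eventually_ge_atTop 1] with r hr
    simp only [A]
    rw [max_eq_left hr, mul_assoc, ← Real.exp_add]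
    have : -K / r + K / r = 0 := by ring
    rw [this, Real.exp_zero, mul_one]

lemma eventually_div_rpow_lt {U U' : ℝ → ℝ} {s : ℝ} (hs : 0 < s)
    (hd : ∀ r, 0 < r → HasDerivAt U (U' r) r)
    (hb : ∀ ε, 0 < ε → ∀ᶠ r in atTop, U' r ≤ ε * r ^ (s - 1)) {η : ℝ} (hη : 0 < η) :
    ∀ᶠ r in atTop, U r / r ^ s < η := by
  obtain ⟨R, hR⟩ := eventually_atTop.1 (hb (s * (η / 2)) (by positivity))
  set R₀ := max R 1
  have hR0 : 0 < R₀ := lt_max_of_lt_right one_pos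
  have hdd : ∀ r ∈ Ici R₀, HasDerivAt (fun r => U r - η / 2 * r ^ s)
      (U' r - η / 2 * (s * r ^ (s - 1))) r := fun r hr => by
    have hr0 := hR0.trans_le hr
    exact (hd r hr0).fun_sub ((Real.hasDerivAt_rpow_const (Or.inl hr0.ne')).const_mul _)
  have hanti : AntitoneOn (fun r => U r - η / 2 * r ^ s) (Ici R₀) := by
    refine antitoneOn_of_deriv_nonpos (convex_Ici _)
      (fun r hr => (hdd r hr).continuousAt.continuousWithinAt)
      (fun r hr => (hdd r (interior_subset hr)).differentiableAt.differentiableWithinAt)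
      fun r hr => ?_
    replace hr : r ∈ Ici R₀ := interior_subset hr
    rw [(hdd r hr).deriv]
    have := hR r ((le_max_left _ _).trans hr)
    linarith
  have hlim : Tendsto (fun r : ℝ => η / 2 * r ^ s) atTop atTop :=
    (tendsto_rpow_atTop hs).const_mul_atTop (by positivity)
  filter_upwards [eventually_ge_atTop R₀,
    hlim.eventually_gt_atTop (U R₀ - η / 2 * R₀ ^ s)] with r hr h2
  have h1 := hanti self_mem_Ici hr hr
  simp only at h1
  rw [div_lt_iff₀ (Real.rpow_pos_of_pos (hR0.trans_le hr) s)]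
  linarith

lemma tendsto_div_rpow_of_deriv {W k : ℝ → ℝ} {s L : ℝ} (hs : 0 < s)
    (hd : ∀ r, 0 < r → HasDerivAt W (r ^ (s - 1) * k r) r) (hk : Tendsto k atTop (𝓝 L)) :
    Tendsto (fun r => W r / r ^ s) atTop (𝓝 (L / s)) := by
  have hdd : ∀ r, 0 < r → HasDerivAt (fun r => W r - L / s * r ^ s)
      (r ^ (s - 1) * (k r - L)) r := fun r hr => by
    refine ((hd r hr).fun_sub
      ((Real.hasDerivAt_rpow_const (Or.inl hr.ne')).const_mul _)).congr_deriv ?_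
    field_simp
  have hb : ∀ ε, 0 < ε → ∀ᶠ r in atTop, |r ^ (s - 1) * (k r - L)| ≤ ε * r ^ (s - 1) :=
    fun ε hε => by
      filter_upwards [Metric.tendsto_nhds.1 hk ε hε, eventually_gt_atTop 0] with r h1 hr
      rw [Real.dist_eq] at h1
      rw [abs_mul, abs_of_pos (Real.rpow_pos_of_pos hr _), mul_comm]
      gcongr
  have hU : Tendsto (fun r => (W r - L / s * r ^ s) / r ^ s) atTop (𝓝 0) := by
    refine Metric.tendsto_nhds.2 fun η hη => ?_
    filter_upwards [eventually_div_rpow_lt hs hdd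
      (fun ε hε => (hb ε hε).mono fun r h => le_of_abs_le h) hη,
      eventually_div_rpow_lt hs (fun r hr => (hdd r hr).fun_neg)
      (fun ε hε => (hb ε hε).mono fun r h => (neg_le_abs _).trans h) hη] with r h1 h2
    rw [Real.dist_eq, sub_zero, abs_lt]
    rw [neg_div] at h2
    exact ⟨by linarith, h1⟩
  have h1 := hU.add_const (L / s)
  rw [zero_add] at h1
  refine h1.congr' ?_
  filter_upwards [eventually_gt_atTop 0] with r hr
  have := (Real.rpow_pos_of_pos hr s).ne'
  field_simp
  ring

/-- The deviation from the cone solves the linearised Euler equation up to a quadratic error. -/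
lemma abs_linearization_error_le {a b α r f v : ℝ} (hb : 0 < b) (hα : 0 < α)
    (haα : a = b * α ^ 2) (hr : 0 < r) (hv0 : 0 < v) (hvα : v < α) (hw : α * r < f)
    (hs : 0 < 2 * r * (v - α) + 5 * (f - α * r)) :
    |r ^ 2 * ((1 + v ^ 2) * (a / f - b * v / r)) + (a + b) * (r * (v - α) + (f - α * r))| ≤
      b * (8 * α ^ 2 + 4 * (1 + α ^ 2)) / α * ((f - α * r) ^ 2 / r) := by
  obtain ⟨w, rfl⟩ : ∃ w, f = α * r + w := ⟨f - α * r, by ring⟩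
  obtain ⟨y, rfl⟩ : ∃ y, v = α - y := ⟨α - v, by ring⟩
  have hw0 : 0 < w := by linarith
  have hy0 : 0 < y := by linarith
  have hyα : y < α := by linarith
  have hry : r * y < 5 / 2 * w := by linarith
  have hry0 : 0 < r * y := mul_pos hr hy0
  have hf : 0 < α * r + w := by positivity
  have e : r ^ 2 * ((1 + (α - y) ^ 2) * (a / (α * r + w) - b * (α - y) / r))
      + (a + b) * (r * (α - y - α) + (α * r + w - α * r)) =
      b / (α * r + w) * (α * (r * y - w) * ((2 * α - y) * -(r * y))
        + (1 + (α - y) ^ 2) * (r * y) * w - (1 + α ^ 2) * (r * y - w) * w) := by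
    rw [haα]
    field_simp
    ring
  rw [e, abs_mul, abs_of_pos (by positivity)]
  have hd : |r * y - w| ≤ 3 / 2 * w := abs_le.2 ⟨by linarith, by linarith⟩
  have t1 : |α * (r * y - w) * ((2 * α - y) * -(r * y))| ≤
      α * (3 / 2 * w) * ((2 * α) * (5 / 2 * w)) := by
    have h0 : 0 ≤ 2 * α - y := by linarith
    rw [abs_mul, abs_mul, abs_mul, abs_neg, abs_of_pos hα, abs_of_nonneg h0, abs_of_pos hry0]
    gcongr
    linarith
  have t2 : |(1 + (α - y) ^ 2) * (r * y) * w| ≤ (1 + α ^ 2) * (5 / 2 * w) * w := by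
    rw [abs_of_pos (by positivity)]
    gcongr
  have t3 : |(1 + α ^ 2) * (r * y - w) * w| ≤ (1 + α ^ 2) * (3 / 2 * w) * w := by
    rw [abs_mul, abs_mul, abs_of_pos hw0, abs_of_pos (show 0 < 1 + α ^ 2 by positivity)]
    gcongr
  have t4 : |α * (r * y - w) * ((2 * α - y) * -(r * y))
        + (1 + (α - y) ^ 2) * (r * y) * w - (1 + α ^ 2) * (r * y - w) * w| ≤
      (8 * α ^ 2 + 4 * (1 + α ^ 2)) * w ^ 2 := by
    refine (abs_sub _ _).trans ((add_le_add_left (abs_add_le _ _) _).trans ?_)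
    have : 0 ≤ α ^ 2 * w ^ 2 := by positivity
    linarith
  calc _ ≤ b / (α * r) * ((8 * α ^ 2 + 4 * (1 + α ^ 2)) * w ^ 2) := by
        gcongr
    _ = _ := by
        field_simp
        ring

lemma profile_asymptotics {a b α γ γ' : ℝ} (hb : 0 < b) (hα : 0 < α) (haα : a = b * α ^ 2)
    (hsum : γ + γ' = 1 - (a + b)) (hprod : γ * γ' = a + b) (hγ' : γ' < -5 / 2) (hγ : γ' < γ)
    {φ v : ℝ → ℝ}
    (hd : ∀ r, 0 < r → HasDerivAt φ (v r) r ∧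
      HasDerivAt v ((1 + v r ^ 2) * (a / φ r - b * v r / r)) r)
    (hv : ∀ r, 0 < r → 0 < v r ∧ v r < α)
    (hφ : ∀ r, 0 < r → α * r < φ r ∧ φ r < α * r + 1)
    (hs : ∀ r, 0 < r → 0 < 2 * r * (v r - α) + 5 * (φ r - α * r)) :
    ∃ κ, 0 < κ ∧ Tendsto (fun r => (φ r - α * r) / (κ * r ^ γ)) atTop (𝓝 1) := by
  let q : ℝ → ℝ := fun r => r * (v r - α) - γ' * (φ r - α * r)
  let err : ℝ → ℝ := fun r => r ^ 2 * ((1 + v r ^ 2) * (a / φ r - b * v r / r))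
    + (a + b) * (r * (v r - α) + (φ r - α * r))
  set c : ℝ := -5 / 2 - γ' with hc
  have hc0 : 0 < c := by linarith
  have hq : ∀ r, 0 < r → c * (φ r - α * r) < q r := fun r hr => by
    have := hs r hr
    simp only [q, hc]
    linarith
  have hq0 : ∀ r, 0 < r → 0 < q r := fun r hr =>
    (mul_pos hc0 (sub_pos.2 (hφ r hr).1)).trans (hq r hr)
  have hdw : ∀ r, 0 < r → HasDerivAt (fun r => φ r - α * r) (v r - α) r := fun r hr => by
    simpa using (hd r hr).1.fun_sub ((hasDerivAt_id' r).const_mul α)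
  have hdh : ∀ r, 0 < r → HasDerivAt (fun r => q r * r ^ (-γ)) (err r * r ^ (-γ - 1)) r :=
    fun r hr => by
      have h1 : HasDerivAt q (1 * (v r - α) + r * ((1 + v r ^ 2) * (a / φ r - b * v r / r))
          - γ' * (v r - α)) r :=
        ((hasDerivAt_id' r).fun_mul ((hd r hr).2.sub_const α)).fun_sub ((hdw r hr).const_mul γ')
      refine (h1.fun_mul (Real.hasDerivAt_rpow_const (p := -γ) (Or.inl hr.ne'))).congr_deriv ?_
      have h2 : r ^ (-γ) = r * r ^ (-γ - 1) := by
        rw [Real.rpow_sub_one hr.ne']; field_simp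
      rw [h2]
      simp only [q, err]
      linear_combination (-(r * (v r - α)) * r ^ (-γ - 1)) * hsum
        + (φ r - α * r) * r ^ (-γ - 1) * hprod
  set M : ℝ := b * (8 * α ^ 2 + 4 * (1 + α ^ 2)) / α with hM
  have hM0 : 0 < M := by positivity
  obtain ⟨L, hL0, hL⟩ := tendsto_of_abs_deriv_le (K := M / c) (by positivity) hdh
    (fun r hr => mul_pos (hq0 r hr) (Real.rpow_pos_of_pos hr _)) fun r hr => by
      have h1 := abs_linearization_error_le hb hα haα hr (hv r hr).1 (hv r hr).2 (hφ r hr).1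
        (hs r hr)
      have hw0 : 0 < φ r - α * r := sub_pos.2 (hφ r hr).1
      have hw1 : φ r - α * r ≤ 1 := by linarith [(hφ r hr).2]
      have hrp := Real.rpow_pos_of_pos hr (-γ - 1)
      have h2 : r ^ (-γ) = r * r ^ (-γ - 1) := by
        rw [Real.rpow_sub_one hr.ne']; field_simp
      rw [abs_mul, abs_of_pos hrp, h2]
      calc _ ≤ M * ((φ r - α * r) ^ 2 / r) * r ^ (-γ - 1) := by gcongr
        _ ≤ M * (q r / c / r) * r ^ (-γ - 1) := by
          gcongr
          rw [le_div_iff₀ hc0]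
          nlinarith [hq r hr, mul_nonneg (mul_nonneg hc0.le hw0.le) (sub_nonneg.2 hw1)]
        _ = _ := by
          field_simp
  have hW := tendsto_div_rpow_of_deriv (W := fun r => (φ r - α * r) * r ^ (-γ'))
    (sub_pos.2 hγ) (fun r hr => by
      refine ((hdw r hr).fun_mul (Real.hasDerivAt_rpow_const (p := -γ')
        (Or.inl hr.ne'))).congr_deriv ?_
      have h2 : r ^ (-γ') = r * r ^ (-γ' - 1) := by
        rw [Real.rpow_sub_one hr.ne']; field_simp
      have h3 : r ^ (-γ' - 1) = r ^ (γ - γ' - 1) * r ^ (-γ) := by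
        rw [← Real.rpow_add hr]; ring_nf
      rw [h2, h3]
      simp only [q]
      ring) hL
  have hκ : 0 < L / (γ - γ') := div_pos hL0 (sub_pos.2 hγ)
  refine ⟨L / (γ - γ'), hκ, ?_⟩
  have h1 := hW.div_const (L / (γ - γ'))
  rw [div_self hκ.ne'] at h1
  refine h1.congr' ?_
  filter_upwards [eventually_gt_atTop 0] with r hr
  have h2 : r ^ (γ - γ') = r ^ γ * r ^ (-γ') := by
    rw [← Real.rpow_add hr]; ring_nf
  have := Real.rpow_pos_of_pos hr (-γ')
  have := Real.rpow_pos_of_pos hr γ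
  rw [h2]
  field_simp

lemma profile_lt {α : ℝ} {φ v : ℝ → ℝ} (hd : ∀ r, 0 < r → HasDerivAt φ (v r) r)
    (hv : ∀ r, 0 < r → v r < α) (hφ0 : Tendsto φ (𝓝[>] 0) (𝓝 1)) {r : ℝ} (hr : 0 < r) :
    φ r < α * r + 1 := by
  have hdw : ∀ r, 0 < r → HasDerivAt (fun r => φ r - α * r) (v r - α) r := fun r hr => by
    simpa using (hd r hr).fun_sub ((hasDerivAt_id' r).const_mul α)
  have hanti : StrictAntiOn (fun r => φ r - α * r) (Ioi 0) := by
    refine strictAntiOn_of_deriv_neg (convex_Ioi _)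
      (fun r hr => (hdw r hr).continuousAt.continuousWithinAt) fun r hr => ?_
    replace hr : 0 < r := interior_subset hr
    rw [(hdw r hr).deriv]
    linarith [hv r hr]
  have hlim : Tendsto (fun r => φ r - α * r) (𝓝[>] 0) (𝓝 1) := by
    have h1 : Tendsto (fun r : ℝ => α * r) (𝓝[>] 0) (𝓝 (α * 0)) :=
      (Continuous.tendsto (by fun_prop) 0).mono_left nhdsWithin_le_nhds
    simpa using hφ0.sub h1
  have hr2 : 0 < r / 2 := by positivity
  have h1 : φ (r / 2) - α * (r / 2) ≤ 1 := by
    refine ge_of_tendsto hlim ?_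
    filter_upwards [Ioo_mem_nhdsGT hr2] with s hs using (hanti hs.1 hr2 hs.2).le
  have h2 := hanti hr2 (mem_Ioi.2 hr) (half_lt_self hr)
  simp only at h2
  linarith

/-- For all real `m̃, ñ` sufficiently close to `m, n`, the modified ODE
`φ̃''/(1+(φ̃')²) + ((ñ−1)/r)φ̃' = (m̃−1)/φ̃` with `φ̃(0⁺) = 1`, `φ̃'(0⁺) = 0` has a unique
solution; it exists on all of `(0,∞)` and satisfies `φ̃'' > 0`, `φ̃ − rφ̃' > 0`,
`α̃₀r < φ̃ < α̃₀r + 1`, `0 < φ̃' < α̃₀` for all `r > 0`, and `φ̃(r) − α̃₀r ∼ κ̃ r^{γ̃}` as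
`r → ∞` for some `κ̃ > 0`. -/
theorem modified_radial_profile
    (n m ℓ : ℕ) (hn : 3 ≤ n) (hm : 2 ≤ m) (hl : 1 ≤ ℓ) (hnm : 8 ≤ n + m) :
    ∃ δ : ℝ, 0 < δ ∧ ∀ m' n' : ℝ, |m' - (m : ℝ)| < δ → |n' - (n : ℝ)| < δ →
      ∃ φ : ℝ → ℝ,
        IsIVPSolTo n' m' φ ⊤ ∧
        (∀ (ψ : ℝ → ℝ) (r₁ : ℝ≥0∞), IsIVPSolTo n' m' ψ r₁ →
          ∀ r : ℝ, 0 < r → ENNReal.ofReal r < r₁ → ψ r = φ r) ∧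
        (∀ r : ℝ, 0 < r →
          0 < deriv (deriv φ) r ∧ 0 < φ r - r * deriv φ r ∧
          Real.sqrt ((m' - 1) / (n' - 1)) * r < φ r ∧
          φ r < Real.sqrt ((m' - 1) / (n' - 1)) * r + 1 ∧
          0 < deriv φ r ∧ deriv φ r < Real.sqrt ((m' - 1) / (n' - 1))) ∧
        ∃ κ : ℝ, 0 < κ ∧
          Tendsto
            (fun r : ℝ => (φ r - Real.sqrt ((m' - 1) / (n' - 1)) * r) / (κ * r ^ gammaR m' n'))
            atTop (𝓝 1) := by
  refine ⟨1 / 100, by norm_num, fun m' n' hm' hn' => ?_⟩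
  rw [abs_lt] at hm' hn'
  have hnR : (3 : ℝ) ≤ n := by exact_mod_cast hn
  have hmR : (2 : ℝ) ≤ m := by exact_mod_cast hm
  have hnmR : (8 : ℝ) ≤ n + m := by exact_mod_cast hnm
  obtain ⟨a, ha'⟩ : ∃ a, a = m' - 1 := ⟨_, rfl⟩
  obtain ⟨b, hb'⟩ : ∃ b, b = n' - 1 := ⟨_, rfl⟩
  have ha : 0 < a := by linarith
  have hb : 1.99 ≤ b := by norm_num; linarith
  have hb0 : 0 < b := by norm_num at hb; linarith
  have hab : 5.98 ≤ a + b := by norm_num; linarith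
  obtain ⟨α, hαdef⟩ : ∃ α, α = Real.sqrt (a / b) := ⟨_, rfl⟩
  have hα : 0 < α := by rw [hαdef]; exact Real.sqrt_pos.2 (div_pos ha hb0)
  have haα : a = b * α ^ 2 := by
    rw [hαdef, Real.sq_sqrt (div_pos ha hb0).le]; field_simp
  obtain ⟨φ, v, hφ0, hv0, h⟩ := exists_profile ha hb hab hα haα
  have hbar : ∀ r, 0 < r → v r < α ∧ α * r < φ r := fun r hr =>
    lt_of_barriers hα hr (h r hr).2.2.1 (h r hr).2.2.2.1 (h r hr).2.2.2.2
  have hφpos : ∀ r, 0 < r → 0 < φ r := fun r hr => (mul_pos hα hr).trans (hbar r hr).2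
  have hup : ∀ r, 0 < r → φ r < α * r + 1 := fun r hr =>
    profile_lt (fun r hr => (h r hr).1) (fun r hr => (hbar r hr).1) hφ0 hr
  have hderiv : ∀ r, 0 < r → deriv φ r = v r := fun r hr => (h r hr).1.deriv
  have hev : ∀ r, 0 < r → deriv φ =ᶠ[𝓝 r] v := fun r hr => by
    filter_upwards [lt_mem_nhds hr] with s hs using hderiv s hs
  have hderiv2 : ∀ r, 0 < r →
      HasDerivAt (deriv φ) ((1 + v r ^ 2) * (a / φ r - b * v r / r)) r := fun r hr =>
    (h r hr).2.1.congr_of_eventuallyEq (hev r hr)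
  rw [← ha', ← hb', ← hαdef]
  refine ⟨φ, ⟨fun r hr _ => ⟨hφpos r hr, (h r hr).1.differentiableAt,
    (hderiv2 r hr).differentiableAt, ?_⟩, hφ0, ?_⟩, fun ψ r₁ hψ r hr hr₁ => ?_,
    fun r hr => ?_, ?_⟩
  · rw [(hderiv2 r hr).deriv, hderiv r hr, ← ha', ← hb']
    have : 1 + v r ^ 2 ≠ 0 := by positivity
    field_simp
    ring
  · refine hv0.congr' ?_
    filter_upwards [self_mem_nhdsWithin] with r hr using (hderiv r hr).symm
  · obtain ⟨hsol, hψ0, hψ1⟩ := hψ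
    refine profile_unique (y := deriv ψ) ha hb0 hr
      (fun s hs => ⟨hφpos s hs.1, (h s hs.1).1, (h s hs.1).2.1⟩) (fun s hs => ?_) hφ0 hv0 hψ0 hψ1
    obtain ⟨p1, p2, p3, p4⟩ := hsol s hs.1 ((ENNReal.ofReal_le_ofReal hs.2).trans_lt hr₁)
    refine ⟨p1, p2.hasDerivAt, p3.hasDerivAt.congr_deriv ?_⟩
    rw [← ha', ← hb'] at p4
    have : 1 + deriv ψ s ^ 2 ≠ 0 := by positivity
    have e : deriv (deriv ψ) s / (1 + deriv ψ s ^ 2) = a / ψ s - b * deriv ψ s / s := by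
      rw [← p4]; ring
    rw [← e]
    field_simp
  · obtain ⟨-, -, h1, h2, -⟩ := h r hr
    obtain ⟨h3, h4⟩ := hbar r hr
    rw [(hderiv2 r hr).deriv, hderiv r hr]
    refine ⟨mul_pos (by positivity) (sub_pos.2 ?_), by nlinarith, h4, hup r hr, h1, h3⟩
    rw [div_lt_div_iff₀ hr (hφpos r hr), haα]
    nlinarith
  · obtain ⟨S, hS⟩ : ∃ S, S = Real.sqrt (((m' + n' - 3) / 2) ^ 2 - (m' + n' - 2)) := ⟨_, rfl⟩
    have hdisc : (0 : ℝ) < ((m' + n' - 3) / 2) ^ 2 - (m' + n' - 2) := by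
      have : 7.98 ≤ m' + n' := by norm_num at hab ⊢; linarith
      nlinarith
    have hSq : S ^ 2 = ((m' + n' - 3) / 2) ^ 2 - (m' + n' - 2) := by
      rw [hS, Real.sq_sqrt hdisc.le]
    have hS0 : 0 < S := by rw [hS]; exact Real.sqrt_pos.2 hdisc
    have hγ : gammaR m' n' = -((m' + n' - 3) / 2) + S := by rw [gammaR, hS]
    rw [hγ]
    refine profile_asymptotics (γ' := -((m' + n' - 3) / 2) - S) hb0 hα haα ?_ ?_ ?_ (by linarith)
      (fun r hr => ⟨(h r hr).1, (h r hr).2.1⟩) (fun r hr => ⟨(h r hr).2.2.1, (hbar r hr).1⟩)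
      (fun r hr => ⟨(hbar r hr).2, hup r hr⟩)
      (fun r hr => slope_defect_bound hα hr (hbar r hr).2 (h r hr).2.2.2.2)
    · rw [ha', hb']; ring
    · rw [ha', hb']; linear_combination -hSq
    · have : 7.98 ≤ m' + n' := by norm_num at hab ⊢; linarith
      by_contra hcon
      have h1 : S ≤ 5 / 2 - (m' + n' - 3) / 2 := by linarith
      nlinarith
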